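/- For m ≥ 1, the Heisenberg Lie superalgebra with odd center H_m over a field F (char F ≠ 2,3) is capable if and only if m = 1. -/

import Mathlib

/-!
Common definitions: Lie superalgebras over a field `F` (char ≠ 2,3 where needed),
graded ideals, centers, capability, epicenter, non-abelian tensor and exterior
products (characterized by generators-and-relations universal properties),
free Lie superalgebras, Schur multipliers, Heisenberg Lie superalgebras, etc.
-/

namespace SuperLie

open Submodule Function Module

universe u v w

/-- The sign `(-1)^{|a||b|}` attached to a pair of `ℤ₂`-degrees. -/
def sg (F : Type u) [Field F] (a b : ZMod 2) : F := (-1 : F) ^ (a.val * b.val)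

/-- A Lie superalgebra over `F`: a `ℤ₂`-graded vector space `L = L₀ ⊕ L₁`
together with an even bilinear bracket satisfying graded skew-symmetry and the
graded Jacobi identity (on homogeneous elements). -/
class LieSuper (F : Type u) [Field F] (L : Type v) [AddCommGroup L] [Module F L] where
  gr : ZMod 2 → Submodule F L
  isCompl_gr : IsCompl (gr 0) (gr 1)
  br : L → L → L
  br_add_left : ∀ x y z : L, br (x + y) z = br x z + br y z
  br_add_right : ∀ x y z : L, br x (y + z) = br x y + br x z
  br_smul_left : ∀ (c : F) (x y : L), br (c • x) y = c • br x y
  br_smul_right : ∀ (c : F) (x y : L), br x (c • y) = c • br x y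
  br_gr : ∀ a b : ZMod 2, ∀ x ∈ gr a, ∀ y ∈ gr b, br x y ∈ gr (a + b)
  br_skew : ∀ a b : ZMod 2, ∀ x ∈ gr a, ∀ y ∈ gr b, br x y = -(sg F a b) • br y x
  br_jacobi : ∀ a b c : ZMod 2, ∀ x ∈ gr a, ∀ y ∈ gr b, ∀ z ∈ gr c,
    sg F a c • br x (br y z) + sg F b a • br y (br z x) + sg F c b • br z (br x y) = 0

/-- The `a`-graded piece of a Lie superalgebra. -/
def grd (F : Type u) [Field F] (L : Type v) [AddCommGroup L] [Module F L] [LieSuper F L]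
    (a : ZMod 2) : Submodule F L :=
  LieSuper.gr a

/-- The bracket of a Lie superalgebra. -/
def sbr (F : Type u) [Field F] {L : Type v} [AddCommGroup L] [Module F L] [LieSuper F L]
    (x y : L) : L :=
  LieSuper.br (F := F) x y

/-- The center `Z(L) = {z ∈ L : [z,x] = 0 for all x ∈ L}`. -/
def centerS (F : Type u) [Field F] (L : Type v) [AddCommGroup L] [Module F L] [LieSuper F L] :
    Submodule F L where
  carrier := {z : L | ∀ x : L, sbr F z x = 0}
  add_mem' := by
    intro a b ha hb x
    simp only [Set.mem_setOf_eq, sbr] at ha hb ⊢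
    rw [LieSuper.br_add_left, ha x, hb x, add_zero]
  zero_mem' := by
    intro x
    have h := LieSuper.br_smul_left (F := F) (0 : F) (0 : L) x
    simp only [Set.mem_setOf_eq, sbr, zero_smul] at h ⊢
    simpa using h
  smul_mem' := by
    intro c a ha x
    simp only [Set.mem_setOf_eq, sbr] at ha ⊢
    rw [LieSuper.br_smul_left, ha x, smul_zero]

/-- Homomorphisms of Lie superalgebras: even (grading preserving) linear maps
which preserve the bracket. -/
def IsHom (F : Type u) [Field F] {L : Type v} {M : Type w}
    [AddCommGroup L] [Module F L] [LieSuper F L]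
    [AddCommGroup M] [Module F M] [LieSuper F M] (f : L →ₗ[F] M) : Prop :=
  (∀ a : ZMod 2, ∀ x ∈ grd F L a, f x ∈ grd F M a) ∧
  (∀ x y : L, f (sbr F x y) = sbr F (f x) (f y))

/-- A bundled Lie superalgebra over `F`. -/
structure LieSupAlg (F : Type u) [Field F] : Type (max u (v + 1)) where
  carrier : Type v
  [iag : AddCommGroup carrier]
  [imo : Module F carrier]
  [ils : LieSuper F carrier]

attribute [instance] LieSupAlg.iag LieSupAlg.imo LieSupAlg.ils

instance (F : Type u) [Field F] : CoeSort (LieSupAlg.{u, v} F) (Type v) :=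
  ⟨LieSupAlg.carrier⟩

/-- A Lie superalgebra `L` is capable if `L ≅ H/Z(H)` for some Lie superalgebra `H`,
i.e. there is a surjective homomorphism onto `L` whose kernel is exactly the center. -/
def Capable (F : Type u) [Field F] (L : Type v) [AddCommGroup L] [Module F L]
    [LieSuper F L] : Prop :=
  ∃ (H : LieSupAlg.{u, max u v} F) (φ : H.carrier →ₗ[F] L),
    IsHom F φ ∧ Surjective φ ∧ LinearMap.ker φ = centerS F H.carrier

/-- Graded ideals of a Lie superalgebra. -/
def IsGIdeal (F : Type u) [Field F] {L : Type v} [AddCommGroup L] [Module F L]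
    [LieSuper F L] (I : Submodule F L) : Prop :=
  (∀ x ∈ I, ∀ y : L, sbr F x y ∈ I) ∧ (∀ y : L, ∀ x ∈ I, sbr F y x ∈ I) ∧
  (∀ x ∈ I, ∃ x0 ∈ I ⊓ grd F L 0, ∃ x1 ∈ I ⊓ grd F L 1, x = x0 + x1)

/-- The graded ideal generated by a subset. -/
def idealClosure (F : Type u) [Field F] {L : Type v} [AddCommGroup L] [Module F L]
    [LieSuper F L] (S : Set L) : Submodule F L :=
  sInf {I : Submodule F L | IsGIdeal F I ∧ S ⊆ ↑I}

/-- `QuotCapable F L N` expresses that the quotient Lie superalgebra `L/N` is capable. -/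
def QuotCapable (F : Type u) [Field F] (L : Type v) [AddCommGroup L] [Module F L]
    [LieSuper F L] (N : Submodule F L) : Prop :=
  ∃ (Q : LieSupAlg.{u, max u v} F) (π : L →ₗ[F] Q.carrier),
    IsHom F π ∧ Surjective π ∧ LinearMap.ker π = N ∧ Capable F Q.carrier

/-- The epicenter `Z^*(L)`: the smallest graded ideal of `L` such that the
corresponding quotient is capable. -/
def IsEpicenter (F : Type u) [Field F] (L : Type v) [AddCommGroup L] [Module F L]
    [LieSuper F L] (Z : Submodule F L) : Prop :=
  IsGIdeal F Z ∧ QuotCapable F L Z ∧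
  ∀ N : Submodule F L, IsGIdeal F N → QuotCapable F L N → Z ≤ N

/-- The submodule `[I,J]` spanned by brackets. -/
def bracketSpan (F : Type u) [Field F] {L : Type v} [AddCommGroup L] [Module F L]
    [LieSuper F L] (I J : Submodule F L) : Submodule F L :=
  Submodule.span F {z : L | ∃ x ∈ I, ∃ y ∈ J, z = sbr F x y}

/-- The derived subalgebra `L' = [L,L]`. -/
def derived (F : Type u) [Field F] (L : Type v) [AddCommGroup L] [Module F L]
    [LieSuper F L] : Submodule F L :=
  bracketSpan F (⊤ : Submodule F L) ⊤

/-- The lower central series of a Lie superalgebra. -/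
def lowerCentral (F : Type u) [Field F] (L : Type v) [AddCommGroup L] [Module F L]
    [LieSuper F L] : ℕ → Submodule F L
  | 0 => ⊤
  | n + 1 => bracketSpan F (lowerCentral F L n) ⊤

/-- A Lie superalgebra is nilpotent if its lower central series terminates at zero. -/
def IsNilp (F : Type u) [Field F] (L : Type v) [AddCommGroup L] [Module F L]
    [LieSuper F L] : Prop :=
  ∃ n : ℕ, lowerCentral F L n = ⊥

/-- An action of a Lie superalgebra `P` on a Lie superalgebra `M`:
an even bilinear map satisfying the two action axioms. -/
structure IsAction (F : Type u) [Field F] {P : Type v} {M : Type v}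
    [AddCommGroup P] [Module F P] [LieSuper F P]
    [AddCommGroup M] [Module F M] [LieSuper F M] (act : P → M → M) : Prop where
  add_left : ∀ (p q : P) (m : M), act (p + q) m = act p m + act q m
  add_right : ∀ (p : P) (m m' : M), act p (m + m') = act p m + act p m'
  smul_left : ∀ (c : F) (p : P) (m : M), act (c • p) m = c • act p m
  smul_right : ∀ (c : F) (p : P) (m : M), act p (c • m) = c • act p m
  grade : ∀ a b : ZMod 2, ∀ p ∈ grd F P a, ∀ m ∈ grd F M b, act p m ∈ grd F M (a + b)
  br_act : ∀ a b : ZMod 2, ∀ p ∈ grd F P a, ∀ p' ∈ grd F P b, ∀ m : M,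
    act (sbr F p p') m = act p (act p' m) - sg F a b • act p' (act p m)
  act_br : ∀ a b : ZMod 2, ∀ p ∈ grd F P a, ∀ m ∈ grd F M b, ∀ m' : M,
    act p (sbr F m m') = sbr F (act p m) m' + sg F a b • sbr F m (act p m')

/-- Compatibility of mutual actions of two Lie superalgebras on each other. -/
def Compatible (F : Type u) [Field F] {M : Type v} {N : Type v}
    [AddCommGroup M] [Module F M] [LieSuper F M]
    [AddCommGroup N] [Module F N] [LieSuper F N]
    (actMN : M → N → N) (actNM : N → M → M) : Prop :=
  (∀ a b : ZMod 2, ∀ m ∈ grd F M a, ∀ n ∈ grd F N b, ∀ n' : N,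
      actMN (actNM n m) n' = -(sg F a b) • sbr F (actMN m n) n') ∧
  (∀ a b : ZMod 2, ∀ m ∈ grd F M a, ∀ n ∈ grd F N b, ∀ m' : M,
      actNM (actMN m n) m' = -(sg F a b) • sbr F (actNM n m) m')

/-- The defining relations of the non-abelian tensor product `M ⊗ N` of Lie
superalgebras (with given mutual actions), satisfied by a pairing `q` into `T`. -/
structure TensorRel (F : Type u) [Field F] {M : Type v} {N : Type v} {T : Type w}
    [AddCommGroup M] [Module F M] [LieSuper F M]
    [AddCommGroup N] [Module F N] [LieSuper F N]
    [AddCommGroup T] [Module F T] [LieSuper F T]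
    (actMN : M → N → N) (actNM : N → M → M) (q : M → N → T) : Prop where
  add_left : ∀ (m m' : M) (n : N), q (m + m') n = q m n + q m' n
  add_right : ∀ (m : M) (n n' : N), q m (n + n') = q m n + q m n'
  smul_left : ∀ (c : F) (m : M) (n : N), q (c • m) n = c • q m n
  smul_right : ∀ (c : F) (m : M) (n : N), q m (c • n) = c • q m n
  grade : ∀ a b : ZMod 2, ∀ m ∈ grd F M a, ∀ n ∈ grd F N b, q m n ∈ grd F T (a + b)
  brk_left : ∀ a b : ZMod 2, ∀ m ∈ grd F M a, ∀ m' ∈ grd F M b, ∀ n : N,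
    q (sbr F m m') n = q m (actMN m' n) - sg F a b • q m' (actMN m n)
  brk_right : ∀ a b c : ZMod 2, ∀ m ∈ grd F M a, ∀ n ∈ grd F N b, ∀ n' ∈ grd F N c,
    q m (sbr F n n') = sg F c (a + b) • q (actNM n' m) n - sg F a b • q (actNM n m) n'
  brk_brk : ∀ a b : ZMod 2, ∀ m ∈ grd F M a, ∀ n ∈ grd F N b, ∀ (m' : M) (n' : N),
    sbr F (q m n) (q m' n') = -(sg F a b) • q (actNM n m) (actMN m' n')

/-- `IsTensorObj F actMN actNM t` says that `(T, t)` is the non-abelian tensor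
product `M ⊗ N`: the pairing `t` satisfies the defining relations and is
universal among all pairings satisfying them. -/
structure IsTensorObj (F : Type u) [Field F] {M : Type v} {N : Type v} {T : Type v}
    [AddCommGroup M] [Module F M] [LieSuper F M]
    [AddCommGroup N] [Module F N] [LieSuper F N]
    [AddCommGroup T] [Module F T] [LieSuper F T]
    (actMN : M → N → N) (actNM : N → M → M) (t : M → N → T) : Prop where
  rel : TensorRel F actMN actNM t
  lift : ∀ (Q : LieSupAlg.{u, max u v} F) (q : M → N → Q.carrier),
    TensorRel F actMN actNM q →
    ∃! h : T →ₗ[F] Q.carrier, IsHom F h ∧ ∀ (m : M) (n : N), h (t m n) = q m n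

/-- The defining relations of the non-abelian exterior square `L ∧ L` of a Lie
superalgebra (the tensor relations for the bracket actions, together with the
graded alternating relations coming from `L □ L`). -/
structure ExtRel (F : Type u) [Field F] {L : Type v} {T : Type w}
    [AddCommGroup L] [Module F L] [LieSuper F L]
    [AddCommGroup T] [Module F T] [LieSuper F T] (q : L → L → T) : Prop where
  toTensor : TensorRel F (fun x y : L => sbr F x y) (fun x y : L => sbr F x y) q
  alt : ∀ a b : ZMod 2, ∀ x ∈ grd F L a, ∀ y ∈ grd F L b, q x y = -(sg F a b) • q y x
  alt_even : ∀ x ∈ grd F L 0, q x x = 0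

/-- `IsExtObj F t` says that `(E, t)` is the non-abelian exterior square `L ∧ L`. -/
structure IsExtObj (F : Type u) [Field F] {L : Type v} {E : Type v}
    [AddCommGroup L] [Module F L] [LieSuper F L]
    [AddCommGroup E] [Module F E] [LieSuper F E] (t : L → L → E) : Prop where
  rel : ExtRel F t
  lift : ∀ (Q : LieSupAlg.{u, max u v} F) (q : L → L → Q.carrier),
    ExtRel F q →
    ∃! h : E →ₗ[F] Q.carrier, IsHom F h ∧ ∀ x y : L, h (t x y) = q x y

/-- A free Lie superalgebra: free on some `ℤ₂`-graded subset `X`. -/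
def IsFreeLieSuper (F : Type u) [Field F] (Fr : Type v) [AddCommGroup Fr] [Module F Fr]
    [LieSuper F Fr] : Prop :=
  ∃ X : ZMod 2 → Set Fr,
    (∀ a : ZMod 2, X a ⊆ (grd F Fr a : Set Fr)) ∧
    ∀ (Q : LieSupAlg.{u, max u v} F) (f : ∀ a : ZMod 2, X a → Q.carrier),
      (∀ (a : ZMod 2) (x : X a), f a x ∈ grd F Q.carrier a) →
      ∃! h : Fr →ₗ[F] Q.carrier,
        IsHom F h ∧ ∀ (a : ZMod 2) (x : X a), h (x : Fr) = f a x

/-- `F' ∩ R`, for a free presentation with kernel `R`. -/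
abbrev schurA (F : Type u) [Field F] (Fr : Type v) [AddCommGroup Fr] [Module F Fr]
    [LieSuper F Fr] (R : Submodule F Fr) : Submodule F Fr :=
  derived F Fr ⊓ R

/-- The Schur multiplier `M(L) = (F' ∩ R)/[R,F]` attached to a free presentation
`0 → R → F → L → 0`. -/
abbrev SchurMul (F : Type u) [Field F] (Fr : Type v) [AddCommGroup Fr] [Module F Fr]
    [LieSuper F Fr] (R : Submodule F Fr) :=
  ↥(schurA F Fr R) ⧸ (Submodule.comap (schurA F Fr R).subtype (bracketSpan F R ⊤))

/-- `L` is (isomorphic to) the special Heisenberg Lie superalgebra `H(m,n)` with even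
center: basis `x₁,…,x_{2m}, z` (even), `y₁,…,y_n` (odd), with `[xᵢ, x_{m+i}] = z`,
`[y_j, y_j] = z` and `z` central. -/
def IsHeisE (F : Type u) [Field F] (m n : ℕ) (L : Type v) [AddCommGroup L] [Module F L]
    [LieSuper F L] : Prop :=
  ∃ (x : Fin (2 * m) → L) (y : Fin n → L) (z : L),
    (∀ i, x i ∈ grd F L 0) ∧ z ∈ grd F L 0 ∧ (∀ j, y j ∈ grd F L 1) ∧
    LinearIndependent F (Sum.elim x (Sum.elim y (fun _ : Unit => z))) ∧
    Submodule.span F (Set.range (Sum.elim x (Sum.elim y (fun _ : Unit => z)))) = ⊤ ∧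
    (∀ i j : Fin (2 * m), sbr F (x i) (x j) =
      if (j : ℕ) = (i : ℕ) + m then z else if (i : ℕ) = (j : ℕ) + m then -z else 0) ∧
    (∀ (i : Fin (2 * m)) (j : Fin n), sbr F (x i) (y j) = 0) ∧
    (∀ (i : Fin (2 * m)) (j : Fin n), sbr F (y j) (x i) = 0) ∧
    (∀ i j : Fin n, sbr F (y i) (y j) = if i = j then z else 0) ∧
    (∀ w : L, sbr F z w = 0) ∧ (∀ w : L, sbr F w z = 0)

/-- `L` is (isomorphic to) the Heisenberg Lie superalgebra `H_m` with odd center: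
basis `x₁,…,x_m` (even), `y₁,…,y_m, z` (odd), with `[x_j, y_j] = z` and `z` central. -/
def IsHeisO (F : Type u) [Field F] (m : ℕ) (L : Type v) [AddCommGroup L] [Module F L]
    [LieSuper F L] : Prop :=
  ∃ (x : Fin m → L) (y : Fin m → L) (z : L),
    (∀ i, x i ∈ grd F L 0) ∧ (∀ j, y j ∈ grd F L 1) ∧ z ∈ grd F L 1 ∧
    LinearIndependent F (Sum.elim x (Sum.elim y (fun _ : Unit => z))) ∧
    Submodule.span F (Set.range (Sum.elim x (Sum.elim y (fun _ : Unit => z)))) = ⊤ ∧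
    (∀ i j : Fin m, sbr F (x i) (x j) = 0) ∧
    (∀ i j : Fin m, sbr F (x i) (y j) = if i = j then z else 0) ∧
    (∀ i j : Fin m, sbr F (y j) (x i) = if i = j then -z else 0) ∧
    (∀ i j : Fin m, sbr F (y i) (y j) = 0) ∧
    (∀ w : L, sbr F z w = 0) ∧ (∀ w : L, sbr F w z = 0)

/-- `A` is (isomorphic to) the abelian Lie superalgebra `A(r | s)` of
superdimension `(r | s)`. -/
def IsAbelSuper (F : Type u) [Field F] (r s : ℕ) (A : Type v) [AddCommGroup A]
    [Module F A] [LieSuper F A] : Prop :=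
  (∀ x y : A, sbr F x y = 0) ∧ Module.Finite F A ∧
  Module.finrank F ↥(grd F A 0) = r ∧ Module.finrank F ↥(grd F A 1) = s

/-- The direct sum (product) of two Lie superalgebras. -/
instance prodLieSuper (F : Type u) [Field F] (A : Type v) (B : Type w)
    [AddCommGroup A] [Module F A] [LieSuper F A]
    [AddCommGroup B] [Module F B] [LieSuper F B] : LieSuper F (A × B) where
  gr a := (grd F A a).prod (grd F B a)
  isCompl_gr := by
    have hA : IsCompl (grd F A 0) (grd F A 1) := LieSuper.isCompl_gr
    have hB : IsCompl (grd F B 0) (grd F B 1) := LieSuper.isCompl_gr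
    constructor
    · rw [disjoint_iff, eq_bot_iff]
      rintro ⟨a, b⟩ h
      rw [Submodule.mem_inf] at h
      obtain ⟨h0, h1⟩ := h
      rw [Submodule.mem_prod] at h0 h1
      have ha : a = 0 := by
        have := hA.disjoint.le_bot (Submodule.mem_inf.mpr ⟨h0.1, h1.1⟩)
        simpa using this
      have hb : b = 0 := by
        have := hB.disjoint.le_bot (Submodule.mem_inf.mpr ⟨h0.2, h1.2⟩)
        simpa using this
      simp [ha, hb, Prod.ext_iff]
    · rw [codisjoint_iff, eq_top_iff]
      rintro ⟨a, b⟩ -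
      have ha' : a ∈ grd F A 0 ⊔ grd F A 1 := by
        rw [hA.codisjoint.eq_top]; trivial
      have hb' : b ∈ grd F B 0 ⊔ grd F B 1 := by
        rw [hB.codisjoint.eq_top]; trivial
      obtain ⟨a0, ha0, a1, ha1, rfl⟩ := Submodule.mem_sup.mp ha'
      obtain ⟨b0, hb0, b1, hb1, rfl⟩ := Submodule.mem_sup.mp hb'
      refine Submodule.mem_sup.mpr ⟨(a0, b0), ?_, (a1, b1), ?_, ?_⟩
      · exact Submodule.mem_prod.mpr ⟨ha0, hb0⟩
      · exact Submodule.mem_prod.mpr ⟨ha1, hb1⟩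
      · rfl
  br x y := (sbr F x.1 y.1, sbr F x.2 y.2)
  br_add_left := by
    intro x y z
    simp only [Prod.fst_add, Prod.snd_add, sbr, LieSuper.br_add_left]
    rfl
  br_add_right := by
    intro x y z
    simp only [Prod.fst_add, Prod.snd_add, sbr, LieSuper.br_add_right]
    rfl
  br_smul_left := by
    intro c x y
    simp only [Prod.smul_fst, Prod.smul_snd, sbr, LieSuper.br_smul_left]
    rfl
  br_smul_right := by
    intro c x y
    simp only [Prod.smul_fst, Prod.smul_snd, sbr, LieSuper.br_smul_right]
    rfl
  br_gr := by
    intro a b x hx y hy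
    rw [Submodule.mem_prod] at hx hy ⊢
    exact ⟨LieSuper.br_gr a b x.1 hx.1 y.1 hy.1, LieSuper.br_gr a b x.2 hx.2 y.2 hy.2⟩
  br_skew := by
    intro a b x hx y hy
    rw [Submodule.mem_prod] at hx hy
    have h1 := LieSuper.br_skew (F := F) a b x.1 hx.1 y.1 hy.1
    have h2 := LieSuper.br_skew (F := F) a b x.2 hx.2 y.2 hy.2
    simp only [sbr]
    rw [Prod.ext_iff]
    exact ⟨h1, h2⟩
  br_jacobi := by
    intro a b c x hx y hy z hz
    rw [Submodule.mem_prod] at hx hy hz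
    have h1 := LieSuper.br_jacobi (F := F) a b c x.1 hx.1 y.1 hy.1 z.1 hz.1
    have h2 := LieSuper.br_jacobi (F := F) a b c x.2 hx.2 y.2 hy.2 z.2 hz.2
    simp only [sbr]
    rw [Prod.ext_iff]
    exact ⟨h1, h2⟩

section helpers

variable {F : Type u} [Field F] {L : Type v} [AddCommGroup L] [Module F L] [LieSuper F L]

theorem sg_ne_zero' (a b : ZMod 2) : sg F a b ≠ 0 := by
  unfold sg
  exact pow_ne_zero _ (neg_ne_zero.mpr one_ne_zero)

theorem sbr_add_left (x y z : L) : sbr F (x + y) z = sbr F x z + sbr F y z :=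
  LieSuper.br_add_left x y z
theorem sbr_add_right (x y z : L) : sbr F x (y + z) = sbr F x y + sbr F x z :=
  LieSuper.br_add_right x y z
theorem sbr_smul_left (c : F) (x y : L) : sbr F (c • x) y = c • sbr F x y :=
  LieSuper.br_smul_left c x y
theorem sbr_smul_right (c : F) (x y : L) : sbr F x (c • y) = c • sbr F x y :=
  LieSuper.br_smul_right c x y
theorem sbr_zero_right (x : L) : sbr F x 0 = 0 := by
  have h := sbr_smul_right (F := F) (0 : F) x (0 : L)
  simpa using h
theorem sbr_gr {a b : ZMod 2} {x y : L} (hx : x ∈ grd F L a) (hy : y ∈ grd F L b) :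
    sbr F x y ∈ grd F L (a + b) := LieSuper.br_gr a b x hx y hy
theorem sbr_skew {a b : ZMod 2} {x y : L} (hx : x ∈ grd F L a) (hy : y ∈ grd F L b) :
    sbr F x y = -(sg F a b) • sbr F y x := LieSuper.br_skew a b x hx y hy
theorem sbr_swap_zero {a b : ZMod 2} {x y : L} (hx : x ∈ grd F L a) (hy : y ∈ grd F L b)
    (h : sbr F y x = 0) : sbr F x y = 0 := by
  rw [sbr_skew hx hy, h, smul_zero]

theorem sbr_jac_zero {a b c : ZMod 2} {x y z : L} (hx : x ∈ grd F L a) (hy : y ∈ grd F L b)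
    (hz : z ∈ grd F L c) (h1 : sbr F z x ∈ centerS F L) (h2 : sbr F x y ∈ centerS F L) :
    sbr F x (sbr F y z) = 0 := by
  have hJ : sg F a c • sbr F x (sbr F y z) + sg F b a • sbr F y (sbr F z x)
    + sg F c b • sbr F z (sbr F x y) = 0 := LieSuper.br_jacobi a b c x hx y hy z hz
  rw [sbr_swap_zero hy (sbr_gr hz hx) (h1 y), sbr_swap_zero hz (sbr_gr hx hy) (h2 z)] at hJ
  simpa [sg_ne_zero'] using hJ

theorem gr_disj {x : L} (h0 : x ∈ grd F L 0) (h1 : x ∈ grd F L 1) : x = 0 := by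
  have := (LieSuper.isCompl_gr (F := F) (L := L)).disjoint.le_bot (Submodule.mem_inf.mpr ⟨h0, h1⟩)
  simpa using this

theorem gr_decomp (x : L) : ∃ x0 ∈ grd F L 0, ∃ x1 ∈ grd F L 1, x0 + x1 = x := by
  have : x ∈ grd F L 0 ⊔ grd F L 1 := by
    have h := (LieSuper.isCompl_gr (F := F) (L := L)).codisjoint.eq_top
    show x ∈ LieSuper.gr 0 ⊔ LieSuper.gr 1
    rw [h]; trivial
  exact Submodule.mem_sup.mp this

theorem lift_hom {K : Type w} [AddCommGroup K] [Module F K] [LieSuper F K]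
    (φ : K →ₗ[F] L) (hφ : IsHom F φ) (hs : Surjective φ) (a : ZMod 2) (x : L)
    (hx : x ∈ grd F L a) : ∃ k ∈ grd F K a, φ k = x := by
  obtain ⟨k, hk⟩ := hs x
  obtain ⟨k0, h0, k1, h1, rfl⟩ := gr_decomp (F := F) k
  have g0 := hφ.1 0 k0 h0
  have g1 := hφ.1 1 k1 h1
  rw [map_add] at hk
  have ha : a = 0 ∨ a = 1 := (by decide : ∀ a : ZMod 2, a = 0 ∨ a = 1) a
  rcases ha with rfl | rfl
  · refine ⟨k0, h0, ?_⟩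
    have e : φ k1 = 0 := gr_disj (F := F)
      (by rw [show φ k1 = x - φ k0 by rw [← hk]; abel]; exact Submodule.sub_mem _ hx g0) g1
    rw [← hk, e, add_zero]
  · refine ⟨k1, h1, ?_⟩
    have e : φ k0 = 0 := gr_disj (F := F) g0
      (by rw [show φ k0 = x - φ k1 by rw [← hk]; abel]; exact Submodule.sub_mem _ hx g1)
    rw [← hk, e, zero_add]

theorem not_capable_of_two {m : ℕ} (hm : 2 ≤ m) (hH : IsHeisO F m L) : ¬ Capable F L := by
  rintro ⟨K, φ, hφ, hs, hker⟩
  obtain ⟨x, y, z, hx, hy, hz, hli, hsp, hxx, hxy, hyx, hyy, hzl, hzr⟩ := hH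
  choose X hX hXx using fun i => lift_hom φ hφ hs 0 (x i) (hx i)
  choose Y hY hYy using fun i => lift_hom φ hφ hs 1 (y i) (hy i)
  have hz0 : z ≠ 0 := hli.ne_zero (Sum.inr (Sum.inr ()))
  have hc : ∀ k, φ k = 0 → k ∈ centerS F K.carrier := fun k hk => by
    rw [← hker]; exact hk
  have hZg : ∀ j, sbr F (X j) (Y j) ∈ grd F K.carrier 1 := fun j => sbr_gr (hX j) (hY j)
  have hZφ : ∀ j, φ (sbr F (X j) (Y j)) = z := fun j => by
    rw [hφ.2, hXx, hYy, hxy, if_pos rfl]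
  -- brackets with all `Z_j` agree
  have hsame : ∀ i j k, sbr F (sbr F (X i) (Y i)) k = sbr F (sbr F (X j) (Y j)) k := by
    intro i j k
    have h := hc (sbr F (X i) (Y i) - sbr F (X j) (Y j)) (by rw [map_sub, hZφ, hZφ, sub_self]) k
    have h2 := sbr_add_left (F := F) (sbr F (X i) (Y i) - sbr F (X j) (Y j)) (sbr F (X j) (Y j)) k
    rw [h, zero_add, sub_add_cancel] at h2
    exact h2
  have hex : ∀ i : Fin m, ∃ j : Fin m, i ≠ j := by
    intro i
    haveI : Nontrivial (Fin m) := Fin.nontrivial_iff_two_le.mpr hm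
    obtain ⟨j, hj⟩ := exists_ne i
    exact ⟨j, hj.symm⟩
  have h0X : ∀ l i, sbr F (sbr F (X l) (Y l)) (X i) = 0 := by
    intro l i
    obtain ⟨j, hj⟩ := hex i
    rw [hsame l j]
    refine sbr_swap_zero (hZg j) (hX i) (sbr_jac_zero (hX i) (hX j) (hY j) (hc _ ?_) (hc _ ?_))
    · rw [hφ.2, hXx, hYy, hyx, if_neg hj]
    · rw [hφ.2, hXx, hXx, hxx]
  have h0Y : ∀ l i, sbr F (sbr F (X l) (Y l)) (Y i) = 0 := by
    intro l i
    obtain ⟨j, hj⟩ := hex i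
    rw [hsame l j]
    refine sbr_swap_zero (hZg j) (hY i) (sbr_jac_zero (hY i) (hX j) (hY j) (hc _ ?_) (hc _ ?_))
    · rw [hφ.2, hYy, hYy, hyy]
    · rw [hφ.2, hXx, hYy, hyx, if_neg hj.symm]
  let i0 : Fin m := ⟨0, by omega⟩
  set Z := sbr F (X i0) (Y i0) with hZ
  have h0Z : sbr F Z Z = 0 := by
    refine sbr_jac_zero (hZg i0) (hX i0) (hY i0) ?_ ?_
    · rw [sbr_swap_zero (hY i0) (hZg i0) (h0Y i0 i0)]; exact Submodule.zero_mem _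
    · rw [h0X i0 i0]; exact Submodule.zero_mem _
  let S : Submodule F K.carrier :=
    { carrier := {k | sbr F Z k = 0}
      add_mem' := by
        intro a b ha hb
        simp only [Set.mem_setOf_eq] at *
        rw [sbr_add_right, ha, hb, add_zero]
      zero_mem' := sbr_zero_right Z
      smul_mem' := by
        intro c a ha
        simp only [Set.mem_setOf_eq] at *
        rw [sbr_smul_right, ha, smul_zero] }
  have hkS : ∀ k, φ k = 0 → k ∈ S := by
    intro k hk
    show sbr F Z k = 0
    obtain ⟨k0, h0, k1, h1, rfl⟩ := gr_decomp (F := F) k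
    have e0 : φ k0 = 0 := gr_disj (F := F) (hφ.1 0 k0 h0) (by
      rw [map_add] at hk
      rw [eq_neg_of_add_eq_zero_left hk]; exact Submodule.neg_mem _ (hφ.1 1 k1 h1))
    have e1 : φ k1 = 0 := by simpa [e0] using hk
    rw [sbr_add_right, sbr_swap_zero (hZg i0) h0 (hc k0 e0 Z),
      sbr_swap_zero (hZg i0) h1 (hc k1 e1 Z), add_zero]
  have hmap : S.map φ = ⊤ := by
    rw [eq_top_iff, ← hsp, Submodule.span_le]
    rintro _ ⟨i | i | i, rfl⟩
    · exact ⟨X i, h0X i0 i, hXx i⟩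
    · exact ⟨Y i, h0Y i0 i, hYy i⟩
    · exact ⟨Z, h0Z, hZφ i0⟩
  have hZc : Z ∈ centerS F K.carrier := by
    intro k
    have : φ k ∈ S.map φ := by rw [hmap]; trivial
    obtain ⟨s, hsS, hse⟩ := this
    have h1 : k - s ∈ S := hkS _ (by rw [map_sub, hse, sub_self])
    have h2 := S.add_mem h1 hsS
    rw [sub_add_cancel] at h2
    exact h2
  rw [← hker] at hZc
  exact hz0 ((hZφ i0).symm.trans hZc)

theorem heis1_coords (hH : IsHeisO F 1 L) : ∃ (X Y Z : L →ₗ[F] F) (x y z : L),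
    x ∈ grd F L 0 ∧ y ∈ grd F L 1 ∧ z ∈ grd F L 1 ∧
    (∀ h, h = X h • x + Y h • y + Z h • z) ∧
    X x = 1 ∧ Y x = 0 ∧ Z x = 0 ∧ X y = 0 ∧ Y y = 1 ∧ Z y = 0 ∧ X z = 0 ∧ Y z = 0 ∧ Z z = 1 ∧
    (∀ h ∈ grd F L 0, Y h = 0 ∧ Z h = 0) ∧ (∀ h ∈ grd F L 1, X h = 0) ∧
    (∀ h k, sbr F h k = (X h * Y k - Y h * X k) • z) := by
  obtain ⟨x, y, z, hx, hy, hz, hli, hsp, hxx, hxy, hyx, hyy, hzl, hzr⟩ := hH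
  let b := Basis.mk hli hsp.ge
  have bx : b (Sum.inl 0) = x 0 := by simp [b]
  have bY : b (Sum.inr (Sum.inl 0)) = y 0 := by simp [b]
  have bz : b (Sum.inr (Sum.inr ())) = z := by simp [b]
  have hdec : ∀ h, h = b.coord (Sum.inl 0) h • x 0 + b.coord (Sum.inr (Sum.inl 0)) h • y 0
      + b.coord (Sum.inr (Sum.inr ())) h • z := by
    intro h
    conv_lhs => rw [← b.sum_repr h]
    rw [Fintype.sum_sum_type, Fintype.sum_sum_type]
    simp only [Finset.univ_unique, Finset.sum_singleton, Basis.coord_apply, add_assoc]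
    rw [← bx, ← bY, ← bz]; rfl
  have c1 : b.coord (Sum.inl 0) (x 0) = 1 := by rw [← bx]; simp
  have c2 : b.coord (Sum.inr (Sum.inl 0)) (x 0) = 0 := by rw [← bx]; simp
  have c3 : b.coord (Sum.inr (Sum.inr ())) (x 0) = 0 := by rw [← bx]; simp
  have c4 : b.coord (Sum.inl 0) (y 0) = 0 := by rw [← bY]; simp
  have c5 : b.coord (Sum.inr (Sum.inl 0)) (y 0) = 1 := by rw [← bY]; simp
  have c6 : b.coord (Sum.inr (Sum.inr ())) (y 0) = 0 := by rw [← bY]; simp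
  have c7 : b.coord (Sum.inl 0) z = 0 := by rw [← bz]; simp
  have c8 : b.coord (Sum.inr (Sum.inl 0)) z = 0 := by rw [← bz]; simp
  have c9 : b.coord (Sum.inr (Sum.inr ())) z = 1 := by rw [← bz]; simp
  generalize b.coord (Sum.inl 0) = X at *
  generalize b.coord (Sum.inr (Sum.inl 0)) = Y at *
  generalize b.coord (Sum.inr (Sum.inr ())) = Z at *
  refine ⟨X, Y, Z, x 0, y 0, z, hx 0, hy 0, hz, hdec, c1, c2, c3, c4, c5, c6, c7, c8, c9,
    ?_, ?_, ?_⟩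
  · intro h hh
    have e : h - X h • x 0 = 0 := by
      refine gr_disj (F := F) (Submodule.sub_mem _ hh (Submodule.smul_mem _ _ (hx 0))) ?_
      have : h - X h • x 0 = Y h • y 0 + Z h • z := by
        conv_lhs => enter [1]; rw [hdec h]
        abel
      rw [this]
      exact Submodule.add_mem _ (Submodule.smul_mem _ _ (hy 0)) (Submodule.smul_mem _ _ hz)
    rw [sub_eq_zero] at e
    rw [e]; simp [c2, c3]
  · intro h hh
    have e : h - (Y h • y 0 + Z h • z) = 0 := by
      refine gr_disj (F := F) ?_ (Submodule.sub_mem _ hh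
        (Submodule.add_mem _ (Submodule.smul_mem _ _ (hy 0)) (Submodule.smul_mem _ _ hz)))
      have : h - (Y h • y 0 + Z h • z) = X h • x 0 := by
        conv_lhs => enter [1]; rw [hdec h]
        abel
      rw [this]
      exact Submodule.smul_mem _ _ (hx 0)
    rw [sub_eq_zero] at e
    rw [e]; simp [c4, c7]
  · intro h k
    conv_lhs => rw [hdec h, hdec k]
    simp only [sbr_add_left, sbr_add_right, sbr_smul_left, sbr_smul_right, hxx, hxy, hyx, hyy,
      hzl, hzr, if_true]
    module

theorem capable_one (hH : IsHeisO F 1 L) : Capable F L := by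
  obtain ⟨X, Y, Z, x, y, z, hx, hy, hz, hdec, c1, c2, c3, c4, c5, c6, c7, c8, c9, h0, h1, hbr⟩ :=
    heis1_coords hH
  have hcases : ∀ a : ZMod 2, a = 0 ∨ a = 1 := by decide
  have s00 : sg F 0 0 = 1 := by simp [sg]
  have s01 : sg F 0 1 = 1 := by simp [sg]
  have s10 : sg F 1 0 = 1 := by simp [sg]
  have s11 : sg F 1 1 = -1 := by simp [sg, ZMod.val_one]
  have e11 : (1 + 1 : ZMod 2) = 0 := by decide
  letI inst : LieSuper F (L × F) :=
    { gr := fun a => (grd F L a).prod (if a = 1 then ⊤ else ⊥)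
      isCompl_gr := by
        constructor
        · rw [disjoint_iff, eq_bot_iff]
          rintro ⟨a, b⟩ h
          obtain ⟨g0, g1⟩ := Submodule.mem_inf.mp h
          rw [Submodule.mem_prod] at g0 g1
          have ha : a = 0 := gr_disj (F := F) g0.1 g1.1
          have hb : b = 0 := by simpa using g0.2
          simp [ha, hb]
        · rw [codisjoint_iff, eq_top_iff]
          rintro ⟨a, b⟩ -
          obtain ⟨a0, ha0, a1, ha1, rfl⟩ := gr_decomp (F := F) a
          refine Submodule.mem_sup.mpr ⟨(a0, 0), ?_, (a1, b), ?_, ?_⟩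
          · exact Submodule.mem_prod.mpr ⟨ha0, Submodule.zero_mem _⟩
          · exact Submodule.mem_prod.mpr ⟨ha1, by simp⟩
          · simp
      br := fun p q => (sbr F p.1 q.1, X p.1 * Z q.1 - Z p.1 * X q.1)
      br_add_left := by
        intro p q r
        ext
        · simp [sbr_add_left]
        · simp; ring
      br_add_right := by
        intro p q r
        ext
        · simp [sbr_add_right]
        · simp; ring
      br_smul_left := by
        intro c p q
        ext
        · simp [sbr_smul_left]
        · simp; ring
      br_smul_right := by
        intro c p q
        ext
        · simp [sbr_smul_right]
        · simp; ring
      br_gr := by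
        intro a b p hp q hq
        rw [Submodule.mem_prod] at hp hq ⊢
        refine ⟨sbr_gr hp.1 hq.1, ?_⟩
        rcases hcases a with rfl | rfl <;> rcases hcases b with rfl | rfl
        · simp [(h0 _ hp.1).2, (h0 _ hq.1).2]
        · simp
        · simp
        · simp [h1 _ hp.1, h1 _ hq.1]
      br_skew := by
        intro a b p hp q hq
        rw [Submodule.mem_prod] at hp hq
        refine Prod.ext (sbr_skew hp.1 hq.1) ?_
        rcases hcases a with rfl | rfl <;> rcases hcases b with rfl | rfl
        · simp [s00]; ring
        · simp [s01]; ring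
        · simp [s10]; ring
        · simp [h1 _ hp.1, h1 _ hq.1]
      br_jacobi := by
        intro a b c p hp q hq r hr
        rw [Submodule.mem_prod] at hp hq hr
        refine Prod.ext (LieSuper.br_jacobi a b c p.1 hp.1 q.1 hq.1 r.1 hr.1) ?_
        simp only [hbr, map_smul, smul_eq_mul, c7, c9, Prod.snd_add, Prod.smul_snd, Prod.snd_zero]
        rcases hcases a with rfl | rfl <;> rcases hcases b with rfl | rfl <;>
          rcases hcases c with rfl | rfl <;>
          simp only [s00, s01, s10, s11] <;>
          first
          | (simp [h0 _ hp.1, h0 _ hq.1, h0 _ hr.1]; done)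
          | (simp [h0 _ hp.1, h0 _ hq.1, h1 _ hr.1]; try ring)
          | (simp [h0 _ hp.1, h1 _ hq.1, h0 _ hr.1]; try ring)
          | (simp [h1 _ hp.1, h0 _ hq.1, h0 _ hr.1]; try ring)
          | (simp [h1 _ hp.1, h1 _ hq.1, h0 _ hr.1]; try ring)
          | (simp [h1 _ hp.1, h0 _ hq.1, h1 _ hr.1]; try ring)
          | (simp [h0 _ hp.1, h1 _ hq.1, h1 _ hr.1]; try ring)
          | (simp [h1 _ hp.1, h1 _ hq.1, h1 _ hr.1]; try ring) }
  have hb : ∀ p q : L × F, sbr F p q = (sbr F p.1 q.1, X p.1 * Z q.1 - Z p.1 * X q.1) :=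
    fun _ _ => rfl
  refine ⟨⟨L × F⟩, LinearMap.fst F L F, ⟨?_, ?_⟩, ?_, ?_⟩
  · intro a p hp
    exact (Submodule.mem_prod.mp hp).1
  · intro p q
    rfl
  · intro l
    exact ⟨(l, 0), rfl⟩
  · ext p
    rw [LinearMap.mem_ker, LinearMap.fst_apply]
    constructor
    · intro hp q
      show sbr F p q = 0
      rw [hb, hbr, hp]; simp
    · intro hp
      have hpx : sbr F p ((x, 0) : L × F) = 0 := hp (x, 0)
      have hpy : sbr F p ((y, 0) : L × F) = 0 := hp (y, 0)
      have hpz : sbr F p ((z, 0) : L × F) = 0 := hp (z, 0)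
      rw [hb, hbr, Prod.ext_iff] at hpx hpy hpz
      have e1 : X p.1 = 0 := by simpa [c7, c9] using hpz.2
      have e2 : Z p.1 = 0 := by simpa [c1, c3] using hpx.2
      have e3 : Y p.1 = 0 := by
        have := congrArg Z hpx.1
        simpa [c1, c2, c9] using this
      rw [hdec p.1, e1, e2, e3]; simp

end helpers

/-- for `m ≥ 1`, the Heisenberg Lie superalgebra with odd center
`H_m` is capable if and only if `m = 1`. -/
theorem heisenberg_odd_capable_iff (F : Type u) [Field F]
    (hchar2 : (2 : F) ≠ 0) (hchar3 : (3 : F) ≠ 0)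
    (m : ℕ) (hm : 1 ≤ m)
    (H : Type v) [AddCommGroup H] [Module F H] [LieSuper F H]
    (hH : IsHeisO F m H) :
    Capable F H ↔ m = 1 := by
  constructor
  · intro hc
    by_contra hne
    exact not_capable_of_two (by omega) hH hc
  · rintro rfl
    exact capable_one hH

end SuperLie
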